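/- arXiv:2201.09457 — 2 statements merged into one kernel-verified Lean document; each statement's English description precedes it below -/
import Mathlib

section
/- For any policy π, any optimal policy π* ∈ Π*, and any state s ∈ S: V^{π}(s) − V^{π*}(s) ≤ (C/(1−γ)²) · max_{s'∈S} Σ_{a∈A} |π(a|s') − π*(a|s')|. -/
/-- A probability distribution on a finite set: nonnegative and sums to 1. -/
def IsDist {A : Type*} [Fintype A] (p : A → ℝ) : Prop :=
  (∀ a, 0 ≤ p a) ∧ ∑ a, p a = 1

/-- A (randomized, stationary) policy. -/
def IsPolicy {S A : Type*} [Fintype A] (π : S → A → ℝ) : Prop :=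
  ∀ s, IsDist (π s)

/-- The Q-function induced by a value function `V`. -/
noncomputable def Qf {S A : Type*} [Fintype S] (γ : ℝ) (c : S → A → ℝ)
    (P : S → A → S → ℝ) (V : S → ℝ) (s : S) (a : A) : ℝ :=
  c s a + γ * ∑ s', P s a s' * V s'

theorem IsDist.sum_mul_le {A : Type*} [Fintype A] {p f : A → ℝ} {M : ℝ} (hp : IsDist p)
    (hf : ∀ a, f a ≤ M) : ∑ a, p a * f a ≤ M :=
  calc ∑ a, p a * f a ≤ ∑ a, p a * M :=
        Finset.sum_le_sum fun a _ => mul_le_mul_of_nonneg_left (hf a) (hp.1 a)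
    _ = M := by rw [← Finset.sum_mul, hp.2, one_mul]

theorem IsDist.abs_sum_mul_le {A : Type*} [Fintype A] {p f : A → ℝ} {M : ℝ} (hp : IsDist p)
    (hf : ∀ a, |f a| ≤ M) : |∑ a, p a * f a| ≤ M := by
  refine abs_le'.2 ⟨hp.sum_mul_le fun a => (abs_le'.1 (hf a)).1, ?_⟩
  rw [← Finset.sum_neg_distrib]
  simpa only [mul_neg] using hp.sum_mul_le fun a => (abs_le'.1 (hf a)).2

theorem abs_Qf_le {S A : Type*} [Fintype S] {γ C B : ℝ} (hγ : 0 ≤ γ) {c : S → A → ℝ}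
    (hC : ∀ s a, |c s a| ≤ C) {P : S → A → S → ℝ} (hP : ∀ s a, IsDist (P s a))
    {V : S → ℝ} (hB : ∀ s, |V s| ≤ B) (s : S) (a : A) :
    |Qf γ c P V s a| ≤ C + γ * B := by
  refine (abs_add_le _ _).trans (add_le_add (hC s a) ?_)
  rw [abs_mul, abs_of_nonneg hγ]
  exact mul_le_mul_of_nonneg_left ((hP s a).abs_sum_mul_le hB) hγ

/-- A solution of the policy evaluation equation is bounded by `C / (1 - γ)`. -/
theorem abs_value_le {S A : Type*} [Fintype S] [Fintype A] {γ C : ℝ} (hγ : 0 ≤ γ) (hγ1 : γ < 1)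
    {c : S → A → ℝ} (hC : ∀ s a, |c s a| ≤ C) {P : S → A → S → ℝ}
    (hP : ∀ s a, IsDist (P s a)) {π : S → A → ℝ} (hπ : IsPolicy π) {V : S → ℝ}
    (hV : ∀ s, V s = ∑ a, π s a * Qf γ c P V s a) (s : S) : |V s| ≤ C / (1 - γ) := by
  have : Nonempty S := ⟨s⟩
  obtain ⟨m, hm⟩ := Finite.exists_max fun s => |V s|
  have h : |V m| ≤ C + γ * |V m| := by
    conv_lhs => rw [hV m]
    exact (hπ m).abs_sum_mul_le (abs_Qf_le hγ hC hP hm m)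
  refine (hm s).trans ?_
  rw [le_div_iff₀ (by linarith)]
  linarith

theorem Qf_sub_Qf_le {S A : Type*} [Fintype S] {γ D : ℝ} (hγ : 0 ≤ γ) (c : S → A → ℝ)
    {P : S → A → S → ℝ} (hP : ∀ s a, IsDist (P s a)) {V W : S → ℝ}
    (hD : ∀ s, V s - W s ≤ D) (s : S) (a : A) :
    Qf γ c P V s a - Qf γ c P W s a ≤ γ * D := by
  have h := mul_le_mul_of_nonneg_left ((hP s a).sum_mul_le hD) hγ
  simp only [mul_sub, Finset.sum_sub_distrib] at h
  simp only [Qf]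
  linarith

theorem sum_mul_le_mul_sum_abs {A : Type*} [Fintype A] (d : A → ℝ) {f : A → ℝ} {B : ℝ}
    (hf : ∀ a, |f a| ≤ B) : ∑ a, d a * f a ≤ B * ∑ a, |d a| := by
  rw [Finset.mul_sum]
  refine Finset.sum_le_sum fun a _ => (le_abs_self _).trans ?_
  rw [abs_mul, mul_comm]
  exact mul_le_mul_of_nonneg_right (hf a) (abs_nonneg _)

/-- the optimality gap is bounded by the ℓ₁ distance of the policies
(first part of Corollary 1). -/
theorem stmt10 {S A : Type*} [Fintype S] [Nonempty S] [Fintype A] [Nonempty A]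
    (γ : ℝ) (hγ : 0 < γ ∧ γ < 1)
    (C : ℝ) (c : S → A → ℝ) (hC : ∀ s a, |c s a| ≤ C)
    (P : S → A → S → ℝ) (hP : ∀ s a, IsDist (P s a))
    (V : (S → A → ℝ) → S → ℝ)
    (hV : ∀ π, IsPolicy π → ∀ s, V π s = ∑ a, π s a * Qf γ c P (V π) s a)
    -- an optimal policy π*
    (πstar : S → A → ℝ) (hπstar : IsPolicy πstar)
    (hoptimal : ∀ π', IsPolicy π' → ∀ s, V πstar s ≤ V π' s)
    -- an arbitrary policy π
    (π : S → A → ℝ) (hπ : IsPolicy π)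
    (s : S) :
    V π s - V πstar s ≤
      (C / (1 - γ) ^ 2) *
        Finset.univ.sup' Finset.univ_nonempty
          (fun s' => ∑ a, |π s' a - πstar s' a|) := by
  obtain ⟨hγ0, hγ1⟩ := hγ
  have h1 : 0 < 1 - γ := by linarith
  set M := Finset.univ.sup' Finset.univ_nonempty (fun s' => ∑ a, |π s' a - πstar s' a|)
  have hVstar := abs_value_le hγ0.le hγ1 hC hP hπstar (hV πstar hπstar)
  have hQ : ∀ s a, |Qf γ c P (V πstar) s a| ≤ C / (1 - γ) := fun s a =>
    (abs_Qf_le hγ0.le hC hP hVstar s a).trans_eq (by field_simp; ring)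
  have hB : 0 ≤ C / (1 - γ) := (abs_nonneg _).trans (hVstar s)
  obtain ⟨m, hm⟩ := Finite.exists_max fun s => V π s - V πstar s
  have hsplit : V π m - V πstar m =
      ∑ a, π m a * (Qf γ c P (V π) m a - Qf γ c P (V πstar) m a) +
        ∑ a, (π m a - πstar m a) * Qf γ c P (V πstar) m a := by
    conv_lhs => rw [hV π hπ m, hV πstar hπstar m]
    rw [← Finset.sum_sub_distrib, ← Finset.sum_add_distrib]
    exact Finset.sum_congr rfl fun a _ => by ring
  have hfuture := (hπ m).sum_mul_le (Qf_sub_Qf_le hγ0.le c hP hm m)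
  have hpolicy := (sum_mul_le_mul_sum_abs (fun a => π m a - πstar m a) (hQ m)).trans
    (mul_le_mul_of_nonneg_left
      (Finset.le_sup' (fun s' => ∑ a, |π s' a - πstar s' a|) (Finset.mem_univ m)) hB)
  refine (hm s).trans ?_
  have hgap : V π m - V πstar m ≤ C / (1 - γ) * M / (1 - γ) := by
    rw [le_div_iff₀ h1]
    linarith
  exact hgap.trans_eq (by field_simp)
end

section
/- Run HPMD with η_k = k + k₀ and τ_k = 1/(k+k₀)², where k₀ = ⌈γ/(1−γ)⌉, and assume |c(s,a)| ≤ C for all (s,a). Then for every s ∈ S and a ∈ A, lim_{k→∞} π_k(a|s) = π*_U(a|s), where π*_U(a|s) = 1/|A*(s)| if a ∈ A*(s) and π*_U(a|s) = 0 otherwise. -/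
open scoped Classical

/-- Kullback–Leibler divergence on a finite set (0·log 0 = 0). -/
noncomputable def KL {A : Type*} [Fintype A] (p q : A → ℝ) : ℝ :=
  ∑ a, p a * Real.log (p a / q a)

/-- Minimal Q-value at a state. -/
noncomputable def Qmin {S A : Type*} [Fintype A] [Nonempty A] (Q : S → A → ℝ) (s : S) : ℝ :=
  Finset.univ.inf' Finset.univ_nonempty (Q s)

/-- The set of optimal actions at a state: A*(s) = argmin_a Q*(s,a). -/
noncomputable def Astar {S A : Type*} [Fintype A] [Nonempty A] (Q : S → A → ℝ) (s : S) :
    Finset A :=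
  Finset.univ.filter (fun a => Q s a = Qmin Q s)

/-- The optimal policy of maximal entropy: uniform over A*(s). -/
noncomputable def piU {S A : Type*} [Fintype A] [Nonempty A] (Q : S → A → ℝ)
    (s : S) (a : A) : ℝ :=
  if a ∈ Astar Q s then 1 / ((Astar Q s).card : ℝ) else 0

open Filter Topology

/-! ### The Kullback–Leibler divergence and Gibbs distributions -/

/-- Each term of a KL divergence, corrected to be nonnegative. -/
lemma mul_klFun_div {x y : ℝ} (hy : 0 < y) :
    y * InformationTheory.klFun (x / y) = x * Real.log (x / y) + y - x := by
  unfold InformationTheory.klFun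
  field_simp

lemma KL_eq_sum_klFun {A : Type*} [Fintype A] {p q : A → ℝ} (hp : IsDist p) (hq : IsDist q)
    (hqpos : ∀ a, 0 < q a) :
    KL p q = ∑ a, q a * InformationTheory.klFun (p a / q a) := by
  simp only [mul_klFun_div (hqpos _), Finset.sum_sub_distrib, Finset.sum_add_distrib, hp.2, hq.2,
    KL]
  ring

lemma KL_nonneg {A : Type*} [Fintype A] {p q : A → ℝ} (hp : IsDist p) (hq : IsDist q)
    (hqpos : ∀ a, 0 < q a) : 0 ≤ KL p q := by
  rw [KL_eq_sum_klFun hp hq hqpos]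
  exact Finset.sum_nonneg fun a _ => mul_nonneg (hqpos a).le
    (InformationTheory.klFun_nonneg (div_nonneg (hp.1 a) (hqpos a).le))

lemma eq_of_KL_nonpos {A : Type*} [Fintype A] {p q : A → ℝ} (hp : IsDist p) (hq : IsDist q)
    (hqpos : ∀ a, 0 < q a) (h : KL p q ≤ 0) (a : A) : p a = q a := by
  have hterm : ∀ a ∈ Finset.univ, 0 ≤ q a * InformationTheory.klFun (p a / q a) := fun a _ =>
    mul_nonneg (hqpos a).le (InformationTheory.klFun_nonneg (div_nonneg (hp.1 a) (hqpos a).le))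
  have h0 := le_antisymm h (KL_nonneg hp hq hqpos)
  rw [KL_eq_sum_klFun hp hq hqpos, Finset.sum_eq_zero_iff_of_nonneg hterm] at h0
  have ha := (mul_eq_zero.1 (h0 a (Finset.mem_univ a))).resolve_left (hqpos a).ne'
  rw [InformationTheory.klFun_eq_zero_iff (div_nonneg (hp.1 a) (hqpos a).le),
    div_eq_one_iff_eq (hqpos a).ne'] at ha
  exact ha

lemma KL_self {A : Type*} [Fintype A] {p : A → ℝ} (hpos : ∀ a, 0 < p a) : KL p p = 0 := by
  simp [KL, div_self (hpos _).ne']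

lemma IsDist.le_one {A : Type*} [Fintype A] {p : A → ℝ} (hp : IsDist p) (a : A) : p a ≤ 1 :=
  hp.2 ▸ Finset.single_le_sum (fun b _ => hp.1 b) (Finset.mem_univ a)

/-- The Gibbs distribution with logits `g`. -/
noncomputable def gibbs {A : Type*} [Fintype A] (g : A → ℝ) (a : A) : ℝ :=
  Real.exp (g a) / ∑ b, Real.exp (g b)

lemma sum_exp_pos {A : Type*} [Fintype A] [Nonempty A] (g : A → ℝ) :
    0 < ∑ b, Real.exp (g b) :=
  Finset.sum_pos (fun _ _ => Real.exp_pos _) Finset.univ_nonempty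

lemma gibbs_pos {A : Type*} [Fintype A] [Nonempty A] (g : A → ℝ) (a : A) : 0 < gibbs g a :=
  div_pos (Real.exp_pos _) (sum_exp_pos g)

lemma isDist_gibbs {A : Type*} [Fintype A] [Nonempty A] (g : A → ℝ) : IsDist (gibbs g) := by
  refine ⟨fun a => (gibbs_pos g a).le, ?_⟩
  simp only [gibbs, ← Finset.sum_div]
  exact div_self (sum_exp_pos g).ne'

lemma gibbs_eq_inv {A : Type*} [Fintype A] (g : A → ℝ) (a : A) :
    gibbs g a = (∑ b, Real.exp (g b - g a))⁻¹ := by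
  simp only [gibbs, Real.exp_sub, ← Finset.sum_div, inv_div]

lemma gibbs_le_exp_sub {A : Type*} [Fintype A] (g : A → ℝ) (a b : A) :
    gibbs g a ≤ Real.exp (g a - g b) := by
  rw [gibbs, Real.exp_sub]
  exact div_le_div_of_nonneg_left (Real.exp_pos _).le (Real.exp_pos _)
    (Finset.single_le_sum (f := fun b => Real.exp (g b)) (fun _ _ => (Real.exp_pos _).le)
      (Finset.mem_univ b))

lemma KL_gibbs {A : Type*} [Fintype A] [Nonempty A] {p : A → ℝ} (hp : IsDist p) (g : A → ℝ) :
    KL p (gibbs g) =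
      ∑ a, p a * (Real.log (p a) - g a) + Real.log (∑ b, Real.exp (g b)) := by
  have hterm : ∀ a, p a * Real.log (p a / gibbs g a) =
      p a * (Real.log (p a) - g a) + p a * Real.log (∑ b, Real.exp (g b)) := by
    intro a
    rcases (hp.1 a).eq_or_lt with h | h
    · simp [← h]
    · rw [Real.log_div h.ne' (gibbs_pos g a).ne', gibbs,
        Real.log_div (Real.exp_pos _).ne' (sum_exp_pos g).ne', Real.log_exp]
      ring
  simp only [KL, hterm, Finset.sum_add_distrib, ← Finset.sum_mul, hp.2, one_mul]

lemma KL_gibbs_zero_le {A : Type*} [Fintype A] [Nonempty A] {p : A → ℝ} (hp : IsDist p) :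
    KL p (gibbs fun _ => 0) ≤ Real.log (Fintype.card A) := by
  rw [KL_gibbs hp]
  have : ∑ a, p a * (Real.log (p a) - 0) ≤ 0 := Finset.sum_nonpos fun a _ => by
    rw [sub_zero]
    exact mul_nonpos_of_nonneg_of_nonpos (hp.1 a) (Real.log_nonpos (hp.1 a) (hp.le_one a))
  simpa using this

/-- A KL-proximal step with KL regularization towards the uniform distribution stays within the
Gibbs family. -/
lemma eq_gibbs_of_isMinimizer {A : Type*} [Fintype A] [Nonempty A] {η τ : ℝ}
    (hw : 0 < 1 + η * τ) (Q g g' : A → ℝ)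
    (hg' : ∀ a, (1 + η * τ) * g' a = g a - η * Q a) {x : A → ℝ} (hx : IsDist x)
    (hmin : ∀ p, IsDist p →
      η * ((∑ a, Q a * x a) + τ * KL x (gibbs fun _ => 0)) + KL x (gibbs g) ≤
      η * ((∑ a, Q a * p a) + τ * KL p (gibbs fun _ => 0)) + KL p (gibbs g)) :
    x = gibbs g' := by
  have key : ∀ p, IsDist p →
      η * ((∑ a, Q a * p a) + τ * KL p (gibbs fun _ => 0)) + KL p (gibbs g) =
      (1 + η * τ) * KL p (gibbs g') + (η * τ * Real.log (∑ _b : A, Real.exp 0)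
        + Real.log (∑ b, Real.exp (g b)) - (1 + η * τ) * Real.log (∑ b, Real.exp (g' b))) := by
    intro p hp
    rw [KL_gibbs hp, KL_gibbs hp, KL_gibbs hp]
    have : η * (∑ a, Q a * p a) + η * τ * (∑ a, p a * (Real.log (p a) - 0)) +
        ∑ a, p a * (Real.log (p a) - g a) =
        (1 + η * τ) * ∑ a, p a * (Real.log (p a) - g' a) := by
      simp only [Finset.mul_sum, ← Finset.sum_add_distrib]
      refine Finset.sum_congr rfl fun a _ => ?_
      linear_combination p a * hg' a
    linear_combination this
  have h := hmin _ (isDist_gibbs g')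
  rw [key x hx, key _ (isDist_gibbs g'), KL_self (gibbs_pos g')] at h
  funext a
  refine eq_of_KL_nonpos hx (isDist_gibbs g') (gibbs_pos g') ?_ a
  by_contra! hpos
  nlinarith [mul_pos hw hpos]

/-! ### Discounted comparison -/

lemma Qf_sub {S A : Type*} [Fintype S] (γ : ℝ) (c : S → A → ℝ) (P : S → A → S → ℝ)
    (V W : S → ℝ) (s : S) (a : A) :
    Qf γ c P V s a - Qf γ c P W s a = γ * ∑ s', P s a s' * (V s' - W s') := by
  simp only [Qf, mul_sub, Finset.sum_sub_distrib]
  ring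

/-- A function that is subharmonic up to `e` for a discounted kernel is at most `e / (1 - γ)`. -/
lemma sub_le_of_le_Qf_sub {S A : Type*} [Fintype S] [Nonempty S] [Fintype A]
    {γ : ℝ} (hγ : 0 < γ ∧ γ < 1) {c : S → A → ℝ} {P : S → A → S → ℝ}
    (hP : ∀ s a, IsDist (P s a)) {π : S → A → ℝ} (hπ : IsPolicy π) {V W : S → ℝ} {e : ℝ}
    (h : ∀ s, V s - W s ≤ e + ∑ a, π s a * (Qf γ c P V s a - Qf γ c P W s a)) (s : S) :
    V s - W s ≤ e / (1 - γ) := by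
  obtain ⟨m, hm⟩ := Finite.exists_max fun s => V s - W s
  have hbound : ∑ a, π m a * (Qf γ c P V m a - Qf γ c P W m a) ≤ γ * (V m - W m) := by
    calc ∑ a, π m a * (Qf γ c P V m a - Qf γ c P W m a)
        ≤ ∑ a, π m a * (γ * (V m - W m)) := by
          refine Finset.sum_le_sum fun a _ => mul_le_mul_of_nonneg_left ?_ ((hπ m).1 a)
          rw [Qf_sub]
          refine mul_le_mul_of_nonneg_left ?_ hγ.1.le
          calc ∑ s', P m a s' * (V s' - W s') ≤ ∑ s', P m a s' * (V m - W m) :=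
                Finset.sum_le_sum fun s' _ => mul_le_mul_of_nonneg_left (hm s') ((hP m a).1 s')
            _ = V m - W m := by rw [← Finset.sum_mul, (hP m a).2, one_mul]
      _ = γ * (V m - W m) := by rw [← Finset.sum_mul, (hπ m).2, one_mul]
  refine (hm s).trans ?_
  rw [le_div_iff₀ (by linarith [hγ.2])]
  linarith [h m]

lemma tendsto_Qf {S A : Type*} [Fintype S] {γ : ℝ} {c : S → A → ℝ} {P : S → A → S → ℝ}
    {V : ℕ → S → ℝ} {W : S → ℝ} (h : ∀ s, Tendsto (fun k => V k s) atTop (𝓝 (W s)))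
    (s : S) (a : A) :
    Tendsto (fun k => Qf γ c P (V k) s a) atTop (𝓝 (Qf γ c P W s a)) :=
  tendsto_const_nhds.add
    ((tendsto_finsetSum _ fun s' _ => (h s').const_mul (P s a s')).const_mul γ)

/-- A sequence bounded below that decreases up to summable errors converges. -/
lemma exists_tendsto_of_le_add_summable {v ε : ℕ → ℝ} {b : ℝ} (hb : ∀ k, b ≤ v k)
    (hε : ∀ k, 0 ≤ ε k) (hsum : Summable ε) (hstep : ∀ k, v (k + 1) ≤ v k + ε k) :
    ∃ l, Tendsto v atTop (𝓝 l) := by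
  have hanti : Antitone fun k => v k - ∑ t ∈ Finset.range k, ε t :=
    antitone_nat_of_succ_le fun k => by
      rw [Finset.sum_range_succ]
      linarith [hstep k]
  have hbdd : BddBelow (Set.range fun k => v k - ∑ t ∈ Finset.range k, ε t) := by
    refine ⟨b - ∑' t, ε t, ?_⟩
    rintro _ ⟨k, rfl⟩
    linarith [hb k, hsum.sum_le_tsum (Finset.range k) fun t _ => hε t]
  exact ⟨_, by simpa using
    (tendsto_atTop_ciInf hanti hbdd).add hsum.hasSum.tendsto_sum_nat⟩

/-! ### Logits of the iterates -/

/-- The logits of the `k`-th iterate, given the sequence of Q-functions at a fixed state. -/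
noncomputable def logit {A : Type*} (k₀ : ℕ) (Q : ℕ → A → ℝ) (k : ℕ) (a : A) : ℝ :=
  -(∑ t ∈ Finset.range k, ((t : ℝ) + k₀) ^ 2 * Q t a) / ((k : ℝ) + k₀)

lemma logit_sub {A : Type*} (k₀ : ℕ) (Q : ℕ → A → ℝ) (k : ℕ) (a b : A) :
    logit k₀ Q k a - logit k₀ Q k b =
      -(∑ t ∈ Finset.range k, ((t : ℝ) + k₀) ^ 2 * (Q t a - Q t b)) / ((k : ℝ) + k₀) := by
  simp only [logit, mul_sub, Finset.sum_sub_distrib]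
  ring

lemma tendsto_natCast_add (k₀ : ℕ) : Tendsto (fun k : ℕ => (k : ℝ) + k₀) atTop atTop :=
  tendsto_atTop_add_const_right _ _ tendsto_natCast_atTop_atTop

lemma eventually_sq_le_sum {k₀ : ℕ} {x : ℕ → ℝ} {δ : ℝ} (hδ : 0 < δ)
    (hx : Tendsto x atTop (𝓝 δ)) :
    ∀ᶠ k : ℕ in atTop,
      ((k : ℝ) + k₀) ^ 2 ≤ ∑ t ∈ Finset.range k, ((t : ℝ) + k₀) ^ 2 * x t := by
  have hgrow : Tendsto (fun k : ℕ => ((k : ℝ) + k₀) * x k) atTop atTop :=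
    (tendsto_natCast_add k₀).atTop_mul_pos hδ hx
  obtain ⟨T, hT⟩ := eventually_atTop.1
    ((hgrow.eventually_ge_atTop 6).and ((tendsto_natCast_add k₀).eventually_ge_atTop 1))
  set y : ℕ → ℝ := fun k => ∑ t ∈ Finset.range k, ((t : ℝ) + k₀) ^ 2 * x t with hy
  have hlow : ∀ k ≥ T, y T - 2 * ((T : ℝ) + k₀) ^ 2 ≤ y k - 2 * ((k : ℝ) + k₀) ^ 2 := by
    intro k hk
    induction k, hk using Nat.le_induction with
    | base => exact le_rfl
    | succ k hk ih =>
      refine ih.trans ?_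
      obtain ⟨h1, h2⟩ := hT k hk
      simp only [hy, Finset.sum_range_succ]
      push_cast
      nlinarith [mul_le_mul_of_nonneg_left h1 (zero_le_one.trans h2)]
  have hsq : Tendsto (fun k : ℕ => ((k : ℝ) + k₀) ^ 2) atTop atTop :=
    (tendsto_pow_atTop two_ne_zero).comp (tendsto_natCast_add k₀)
  filter_upwards [eventually_ge_atTop T,
    hsq.eventually_ge_atTop (-(y T - 2 * ((T : ℝ) + k₀) ^ 2))] with k hk hk'
  linarith [hlow k hk]

lemma eventually_exp_logit_sub_le {A : Type*} {k₀ : ℕ} (hk₀ : 0 < k₀) {Q : ℕ → A → ℝ} {q : A → ℝ}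
    (hQ : ∀ a, Tendsto (fun k => Q k a) atTop (𝓝 (q a))) {a b : A} (hab : q b < q a) :
    ∀ᶠ k : ℕ in atTop,
      Real.exp (logit k₀ Q k a - logit k₀ Q k b) ≤ Real.exp (-((k : ℝ) + k₀)) := by
  filter_upwards [eventually_sq_le_sum (k₀ := k₀) (sub_pos.2 hab) ((hQ a).sub (hQ b))] with k hk
  have hpos : (0 : ℝ) < (k : ℝ) + k₀ := by positivity
  rw [Real.exp_le_exp, logit_sub, div_le_iff₀ hpos]
  linarith

lemma tendsto_sq_mul_exp_logit_sub {A : Type*} {k₀ : ℕ} (hk₀ : 0 < k₀) {Q : ℕ → A → ℝ} {q : A → ℝ}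
    (hQ : ∀ a, Tendsto (fun k => Q k a) atTop (𝓝 (q a))) {a b : A} (hab : q b < q a) :
    Tendsto (fun k : ℕ => ((k : ℝ) + k₀) ^ 2 *
      Real.exp (logit k₀ Q k a - logit k₀ Q k b)) atTop (𝓝 0) := by
  refine squeeze_zero' (Eventually.of_forall fun k => by positivity) ?_
    ((Real.tendsto_pow_mul_exp_neg_atTop_nhds_zero 2).comp (tendsto_natCast_add k₀))
  filter_upwards [eventually_exp_logit_sub_le hk₀ hQ hab] with k hk
  exact mul_le_mul_of_nonneg_left hk (by positivity)

lemma tendsto_exp_logit_sub {A : Type*} {k₀ : ℕ} (hk₀ : 0 < k₀) {Q : ℕ → A → ℝ} {q : A → ℝ}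
    (hQ : ∀ a, Tendsto (fun k => Q k a) atTop (𝓝 (q a))) {a b : A} (hab : q b < q a) :
    Tendsto (fun k : ℕ => Real.exp (logit k₀ Q k a - logit k₀ Q k b)) atTop (𝓝 0) := by
  refine squeeze_zero' (Eventually.of_forall fun k => (Real.exp_pos _).le)
    (eventually_exp_logit_sub_le hk₀ hQ hab)
    (Real.tendsto_exp_neg_atTop_nhds_zero.comp (tendsto_natCast_add k₀))

lemma tendsto_logit_sub_zero {A : Type*} {k₀ : ℕ} {Q : ℕ → A → ℝ} {a b : A}
    (h : Tendsto (fun k : ℕ => ((k : ℝ) + k₀) ^ 2 * (Q k a - Q k b)) atTop (𝓝 0)) :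
    Tendsto (fun k : ℕ => logit k₀ Q k a - logit k₀ Q k b) atTop (𝓝 0) := by
  refine squeeze_zero_norm' ?_ (by simpa using h.cesaro.norm)
  filter_upwards [eventually_gt_atTop 0] with k hk
  have hk' : (0 : ℝ) < k := by exact_mod_cast hk
  rw [logit_sub, norm_div, norm_neg, div_eq_inv_mul, Real.norm_eq_abs ((k : ℝ) + k₀),
    abs_of_pos (by positivity), Real.norm_eq_abs]
  refine mul_le_mul_of_nonneg_right ?_ (abs_nonneg _)
  exact inv_anti₀ hk' (by linarith [(Nat.cast_nonneg k₀ : (0 : ℝ) ≤ k₀)])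

/-! ### Minimal Q-values -/

lemma Qmin_le {S A : Type*} [Fintype A] [Nonempty A] (Q : S → A → ℝ) (s : S) (a : A) :
    Qmin Q s ≤ Q s a :=
  Finset.inf'_le _ (Finset.mem_univ a)

lemma exists_eq_Qmin {S A : Type*} [Fintype A] [Nonempty A] (Q : S → A → ℝ) (s : S) :
    ∃ a, Q s a = Qmin Q s := by
  obtain ⟨a, _, ha⟩ := Finset.exists_mem_eq_inf' Finset.univ_nonempty (Q s)
  exact ⟨a, ha.symm⟩

lemma mem_Astar {S A : Type*} [Fintype A] [Nonempty A] {Q : S → A → ℝ} {s : S} {a : A} :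
    a ∈ Astar Q s ↔ Q s a = Qmin Q s := by
  simp [Astar]

lemma lt_of_notMem_Astar {S A : Type*} [Fintype A] [Nonempty A] {Q : S → A → ℝ} {s : S}
    {a b : A} (ha : a ∉ Astar Q s) (hb : b ∈ Astar Q s) : Q s b < Q s a := by
  rw [mem_Astar.1 hb]
  exact lt_of_le_of_ne (Qmin_le Q s a) fun h => ha (mem_Astar.2 h.symm)

lemma Qmin_le_sum {S A : Type*} [Fintype A] [Nonempty A] (Q : S → A → ℝ) (s : S) {p : A → ℝ}
    (hp : IsDist p) : Qmin Q s ≤ ∑ a, p a * Q s a :=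
  calc Qmin Q s = ∑ a, p a * Qmin Q s := by rw [← Finset.sum_mul, hp.2, one_mul]
    _ ≤ ∑ a, p a * Q s a :=
      Finset.sum_le_sum fun a _ => mul_le_mul_of_nonneg_left (Qmin_le Q s a) (hp.1 a)

/-- last-iterate policy convergence of sublinearly converging HPMD
(Theorem 8): π_k → π*_U, the maximal-entropy optimal policy. -/
theorem stmt15 {S A : Type*} [Fintype S] [Nonempty S] [Fintype A] [Nonempty A]
    (γ : ℝ) (hγ : 0 < γ ∧ γ < 1)
    (C : ℝ) (c : S → A → ℝ) (hC : ∀ s a, |c s a| ≤ C)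
    (P : S → A → S → ℝ) (hP : ∀ s a, IsDist (P s a))
    (V : (S → A → ℝ) → S → ℝ)
    (hV : ∀ π, IsPolicy π → ∀ s, V π s = ∑ a, π s a * Qf γ c P (V π) s a)
    (πstar : S → A → ℝ) (hπstar : IsPolicy πstar)
    (hoptimal : ∀ π', IsPolicy π' → ∀ s, V πstar s ≤ V π' s)
    (ν : S → ℝ) (hν : IsDist ν) (hνpos : ∀ s, 0 < ν s)
    (hνstat : ∀ s', ν s' = ∑ s, ν s * ∑ a, πstar s a * P s a s')
    -- Q* = Q^{π*}
    (Qst : S → A → ℝ) (hQst : Qst = Qf γ c P (V πstar))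
    -- some state has a suboptimal action (A*(s) ≠ A for some s)
    (hgap : ∃ s a, Qst s a ≠ Qmin Qst s)
    -- HPMD parameters: η_k = k + k₀, τ_k = 1/(k+k₀)², with k₀ = ⌈γ/(1−γ)⌉
    (k₀ : ℕ) (hk₀ : k₀ = ⌈γ / (1 - γ)⌉₊)
    (η τ : ℕ → ℝ)
    (hηdef : ∀ k, η k = (k : ℝ) + (k₀ : ℝ))
    (hτdef : ∀ k, τ k = 1 / ((k : ℝ) + (k₀ : ℝ))^2)
    -- HPMD iterates
    (π : ℕ → S → A → ℝ) (hpol : ∀ k, IsPolicy (π k))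
    (hinit : ∀ s a, π 0 s a = 1 / (Fintype.card A : ℝ))
    (hstep : ∀ k s, ∀ p : A → ℝ, IsDist p →
      η k * ((∑ a, Qf γ c P (V (π k)) s a * π (k+1) s a) + τ k * KL (π (k+1) s) (π 0 s))
          + KL (π (k+1) s) (π k s) ≤
      η k * ((∑ a, Qf γ c P (V (π k)) s a * p a) + τ k * KL p (π 0 s)) + KL p (π k s)) :
    ∀ s a, Filter.Tendsto (fun k => π k s a) Filter.atTop (nhds (piU Qst s a)) := by
  have hk₀pos : 0 < k₀ := by
    rw [hk₀, Nat.ceil_pos]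
    exact div_pos hγ.1 (sub_pos.2 hγ.2)
  have hn : ∀ k : ℕ, (0 : ℝ) < (k : ℝ) + k₀ := fun k => by positivity
  have hγ' : 0 < 1 - γ := sub_pos.2 hγ.2
  let Q : ℕ → S → A → ℝ := fun k => Qf γ c P (V (π k))
  have hητ : ∀ k, 1 + η k * τ k = ((k : ℝ) + k₀ + 1) / ((k : ℝ) + k₀) := fun k => by
    have := (hn k).ne'
    rw [hηdef, hτdef]
    field_simp
  have hηpos : ∀ k, 0 < η k := fun k => by rw [hηdef]; exact hn k
  have hτpos : ∀ k, 0 < τ k := fun k => by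
    rw [hτdef]
    exact one_div_pos.2 (pow_pos (hn k) 2)
  have hπ0 : ∀ s, π 0 s = gibbs fun _ => 0 := fun s => by
    funext a
    simp [hinit, gibbs]
  -- the iterates are Gibbs distributions
  have hgibbs : ∀ k s, π k s = gibbs (logit k₀ (fun t => Q t s) k) := by
    intro k s
    induction k with
    | zero =>
      rw [hπ0]
      congr 1
      funext a
      simp [logit]
    | succ k ih =>
      refine eq_gibbs_of_isMinimizer (η := η k) (τ := τ k) ?_ (Q k s)
        (logit k₀ (fun t => Q t s) k) _ ?_ (hpol (k + 1) s) ?_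
      · have := mul_pos (hηpos k) (hτpos k)
        linarith
      · intro a
        have h1 := (hn k).ne'
        have h2 := (hn (k + 1)).ne'
        rw [hητ, hηdef, logit, logit, Finset.sum_range_succ]
        push_cast at h2 ⊢
        have h3 : (k : ℝ) + k₀ + 1 ≠ 0 := by
          rw [add_right_comm]
          exact h2
        rw [add_right_comm (k : ℝ) 1]
        field_simp
        ring
      · intro p hp
        have := hstep k s p hp
        rwa [hπ0 s, ih] at this
  have hπpos : ∀ k s a, 0 < π k s a := fun k s a => by
    rw [hgibbs]
    exact gibbs_pos _ a
  -- approximate policy improvement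
  have himprove : ∀ k s, ∑ a, π (k + 1) s a * Q k s a ≤
      V (π k) s + τ k * Real.log (Fintype.card A) := by
    intro k s
    have h := hstep k s (π k s) (hpol k s)
    rw [KL_self (hπpos k s)] at h
    have h1 := KL_nonneg (hpol (k + 1) s) (hpol k s) (hπpos k s)
    have h2 := KL_nonneg (hpol (k + 1) s) (hpol 0 s) (hπpos 0 s)
    have h3 : KL (π k s) (π 0 s) ≤ Real.log (Fintype.card A) := by
      rw [hπ0 s]
      exact KL_gibbs_zero_le (hpol k s)
    have h4 := hV (π k) (hpol k) s
    simp only [mul_comm (Qf _ _ _ _ _ _)] at h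
    rw [← h4] at h
    have h5 := le_of_mul_le_mul_left (by linarith :
      η k * ((∑ a, π (k + 1) s a * Q k s a) + τ k * KL (π (k + 1) s) (π 0 s)) ≤
        η k * (V (π k) s + τ k * KL (π k s) (π 0 s))) (hηpos k)
    linarith [mul_le_mul_of_nonneg_left h3 (hτpos k).le, mul_nonneg (hτpos k).le h2]
  have hdescent : ∀ s k, V (π (k + 1)) s ≤
      V (π k) s + τ k * Real.log (Fintype.card A) / (1 - γ) := by
    intro s k
    have := sub_le_of_le_Qf_sub (c := c) (V := V (π (k + 1))) (W := V (π k))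
      (e := τ k * Real.log (Fintype.card A)) hγ hP (hpol (k + 1)) (fun s => by
        rw [hV _ (hpol (k + 1)) s]
        simp only [mul_sub, Finset.sum_sub_distrib]
        linarith [himprove k s]) s
    linarith
  have hτsum : Summable τ := by
    have := (summable_nat_add_iff k₀).2 (Real.summable_one_div_nat_pow.2 one_lt_two)
    refine this.congr fun k => ?_
    rw [hτdef]
    push_cast
    rfl
  have hlim : ∀ s, ∃ l, Tendsto (fun k => V (π k) s) atTop (𝓝 l) := fun s =>
    exists_tendsto_of_le_add_summable (fun k => hoptimal (π k) (hpol k) s)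
      (fun k => div_nonneg (mul_nonneg (hτpos k).le (Real.log_natCast_nonneg _)) hγ'.le)
      ((hτsum.mul_right _).div_const _) (hdescent s)
  choose W hW using hlim
  have hQW : ∀ s a, Tendsto (fun k => Q k s a) atTop (𝓝 (Qf γ c P W s a)) := tendsto_Qf hW
  -- suboptimal actions for the limiting Q-function lose all their mass
  have hmass : ∀ s a, a ∉ Astar (Qf γ c P W) s →
      Tendsto (fun k : ℕ => ((k : ℝ) + k₀) ^ 2 * π k s a) atTop (𝓝 0) ∧
        Tendsto (fun k => π k s a) atTop (𝓝 0) := by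
    intro s a ha
    obtain ⟨b, hb⟩ := exists_eq_Qmin (Qf γ c P W) s
    have hlt := lt_of_notMem_Astar ha (mem_Astar.2 hb)
    have hle : ∀ k, π k s a ≤ Real.exp (logit k₀ (fun t => Q t s) k a -
        logit k₀ (fun t => Q t s) k b) := fun k => by
      rw [hgibbs]
      exact gibbs_le_exp_sub _ a b
    exact ⟨squeeze_zero (fun k => mul_nonneg (sq_nonneg _) (hπpos k s a).le)
        (fun k => mul_le_mul_of_nonneg_left (hle k) (sq_nonneg _))
        (tendsto_sq_mul_exp_logit_sub hk₀pos (hQW s) hlt),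
      squeeze_zero (fun k => (hπpos k s a).le) hle
        (tendsto_exp_logit_sub hk₀pos (hQW s) hlt)⟩
  -- the limiting value function solves the Bellman optimality equation
  have hbellman : ∀ s, W s = Qmin (Qf γ c P W) s := by
    intro s
    have hterm : ∀ a, Tendsto (fun k => π k s a * (Q k s a - Qmin (Qf γ c P W) s)) atTop
        (𝓝 0) := by
      intro a
      by_cases ha : a ∈ Astar (Qf γ c P W) s
      · refine squeeze_zero_norm (fun k => ?_)
          (by simpa [mem_Astar.1 ha] using ((hQW s a).sub_const (Qmin (Qf γ c P W) s)).norm)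
        rw [norm_mul, Real.norm_of_nonneg (hπpos k s a).le]
        exact mul_le_of_le_one_left (norm_nonneg _) ((hpol k s).le_one a)
      · simpa using (hmass s a ha).2.mul ((hQW s a).sub_const _)
    have hsum := tendsto_finsetSum Finset.univ fun a _ => hterm a
    have heq : ∀ k, ∑ a, π k s a * (Q k s a - Qmin (Qf γ c P W) s) =
        V (π k) s - Qmin (Qf γ c P W) s := fun k => by
      simp only [mul_sub, Finset.sum_sub_distrib, ← Finset.sum_mul, (hpol k s).2, one_mul]
      rw [hV _ (hpol k) s]
    simp only [heq, Finset.sum_const_zero] at hsum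
    exact sub_eq_zero.1 (tendsto_nhds_unique ((hW s).sub_const _) hsum)
  have hWstar : W = V πstar := by
    funext s
    refine le_antisymm ?_ (ge_of_tendsto' (hW s) fun k => hoptimal _ (hpol k) s)
    have := sub_le_of_le_Qf_sub (c := c) (V := W) (W := V πstar) (e := 0) hγ hP hπstar
      (fun s => by
        rw [hV _ hπstar s]
        simp only [mul_sub, Finset.sum_sub_distrib]
        linarith [hbellman s, Qmin_le_sum (Qf γ c P W) s (hπstar s)]) s
    simpa using this
  rw [hWstar] at hmass hQW hbellman
  rw [← hQst] at hmass hQW hbellman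
  -- the value gap vanishes faster than the inverse square of the step index
  let e : ℕ → ℝ := fun k => ∑ s, ∑ a, π k s a * (Qst s a - V πstar s)
  have hadv : ∀ k s a, 0 ≤ π k s a * (Qst s a - V πstar s) := fun k s a =>
    mul_nonneg (hπpos k s a).le (sub_nonneg.2 (hbellman s ▸ Qmin_le Qst s a))
  have he : Tendsto (fun k : ℕ => ((k : ℝ) + k₀) ^ 2 * e k) atTop (𝓝 0) := by
    simp only [e, Finset.mul_sum, ← mul_assoc]
    have : ∀ s a, Tendsto (fun k : ℕ => ((k : ℝ) + k₀) ^ 2 * π k s a * (Qst s a - V πstar s))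
        atTop (𝓝 0) := by
      intro s a
      by_cases ha : a ∈ Astar Qst s
      · simp [mem_Astar.1 ha, hbellman s]
      · simpa using (hmass s a ha).1.mul_const _
    simpa using tendsto_finsetSum Finset.univ fun s _ =>
      tendsto_finsetSum Finset.univ fun a _ => this s a
  have hgapV : ∀ k s, V (π k) s - V πstar s ≤ e k / (1 - γ) := by
    intro k s
    refine sub_le_of_le_Qf_sub (c := c) hγ hP (hpol k) (fun s => ?_) s
    have h1 : ∑ a, π k s a * (Qst s a - V πstar s) ≤ e k :=
      Finset.single_le_sum (f := fun s => ∑ a, π k s a * (Qst s a - V πstar s))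
        (fun s _ => Finset.sum_nonneg fun a _ => hadv k s a) (Finset.mem_univ s)
    rw [← hQst, hV _ (hpol k) s]
    simp only [mul_sub, Finset.sum_sub_distrib, ← Finset.sum_mul, (hpol k s).2, one_mul] at h1 ⊢
    linarith
  have hVfast : ∀ s, Tendsto (fun k : ℕ => ((k : ℝ) + k₀) ^ 2 * (V (π k) s - V πstar s)) atTop
      (𝓝 0) := fun s =>
    squeeze_zero
      (fun k => mul_nonneg (sq_nonneg _) (sub_nonneg.2 (hoptimal _ (hpol k) s)))
      (fun k => (mul_le_mul_of_nonneg_left (hgapV k s) (sq_nonneg _)).trans_eq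
        (mul_div_assoc _ _ _).symm)
      (by simpa using he.div_const (1 - γ))
  have hQfast : ∀ s a, Tendsto (fun k : ℕ => ((k : ℝ) + k₀) ^ 2 * (Q k s a - Qst s a)) atTop
      (𝓝 0) := by
    intro s a
    have h := (tendsto_finsetSum Finset.univ fun s' _ =>
      (hVfast s').const_mul (P s a s')).const_mul γ
    simp only [mul_zero, Finset.sum_const_zero] at h
    refine h.congr fun k => ?_
    rw [hQst, Qf_sub]
    simp only [Finset.mul_sum]
    exact Finset.sum_congr rfl fun s' _ => by ring
  intro s a
  by_cases ha : a ∈ Astar Qst s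
  · have hterm : ∀ b, Tendsto (fun k => Real.exp (logit k₀ (fun t => Q t s) k b -
        logit k₀ (fun t => Q t s) k a)) atTop (𝓝 (if b ∈ Astar Qst s then 1 else 0)) := by
      intro b
      split_ifs with hb
      · have hQab : Qst s b = Qst s a := (mem_Astar.1 hb).trans (mem_Astar.1 ha).symm
        have h := (hQfast s b).sub (hQfast s a)
        rw [sub_zero] at h
        have h0 := tendsto_logit_sub_zero (k₀ := k₀) (Q := fun t => Q t s) (a := b) (b := a)
          (h.congr fun k => by rw [hQab]; ring)
        simpa [Function.comp_def] using (Real.continuous_exp.tendsto 0).comp h0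
      · exact tendsto_exp_logit_sub hk₀pos (hQW s) (lt_of_notMem_Astar hb ha)
    have hsum := tendsto_finsetSum Finset.univ fun b _ => hterm b
    have hcard : ((Astar Qst s).card : ℝ) ≠ 0 :=
      Nat.cast_ne_zero.2 (Finset.card_ne_zero_of_mem ha)
    rw [Finset.sum_ite_mem, Finset.univ_inter, Finset.sum_const, nsmul_one] at hsum
    simp only [hgibbs, gibbs_eq_inv, piU, if_pos ha, one_div]
    exact hsum.inv₀ hcard
  · rw [piU, if_neg ha]
    exact (hmass s a ha).2
end
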